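/- The Szegő function D satisfies the scalar Riemann–Hilbert problem for D: (a) D is analytic and nowhere zero on ℂ∖[−1,1]; (b) for every x ∈ (−1,1), the boundary values D₊(x) = lim_{ε→0⁺} D(x+iε) and D₋(x) = lim_{ε→0⁺} D(x−iε) exist and satisfy D₊(x)·D₋(x) = w(x); (c) D(z) → D_∞ as z → ∞, and D_∞ is a positive real number. -/

import Mathlib

open Complex Filter Set MeasureTheory

noncomputable section

/-- The segment [-1,1] regarded as a subset of the complex plane. -/
def seg : Set ℂ := Complex.ofReal '' Set.Icc (-1) 1

theorem seg_isCompact : IsCompact seg :=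
  isCompact_Icc.image Complex.continuous_ofReal

theorem sub_ne_of_seg {z : ℂ} (hz : z ∈ segᶜ) {t : ℝ} (ht : t ∈ Set.Icc (-1:ℝ) 1) :
    z - (t:ℂ) ≠ 0 := by
  intro h0
  apply hz
  exact ⟨t, ht, (sub_eq_zero.mp h0).symm⟩

theorem im_mem_compl {z : ℂ} (hz : z.im ≠ 0) : z ∈ segᶜ := by
  rintro ⟨t, _, rfl⟩
  simp at hz

theorem uIoc_mem_Icc {t : ℝ} (ht : t ∈ Set.uIoc (-1:ℝ) 1) : t ∈ Set.Icc (-1:ℝ) 1 := by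
  rw [Set.uIoc_of_le (by norm_num)] at ht
  exact ⟨ht.1.le, ht.2⟩

theorem cauchy_meas {g : ℝ → ℝ} (hg : IntervalIntegrable g volume (-1) 1) (z : ℂ) :
    AEStronglyMeasurable (fun t : ℝ => (g t : ℂ) / (z - (t:ℂ)))
      (volume.restrict (Set.uIoc (-1:ℝ) 1)) := by
  have h1 : AEStronglyMeasurable g (volume.restrict (Set.uIoc (-1:ℝ) 1)) :=
    hg.def'.aestronglyMeasurable
  have h2 : Measurable (fun t : ℝ => (z - (t:ℂ))⁻¹) := by fun_prop
  simp only [div_eq_mul_inv]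
  exact (Complex.continuous_ofReal.comp_aestronglyMeasurable h1).mul h2.aestronglyMeasurable

theorem cauchy_diff {g : ℝ → ℝ} (hg : IntervalIntegrable g volume (-1) 1) {z : ℂ}
    (hz : z ∈ segᶜ) :
    DifferentiableAt ℂ (fun z : ℂ => ∫ t in (-1:ℝ)..1, (g t : ℂ) / (z - (t:ℂ))) z := by
  obtain ⟨δ, hδ, hball⟩ := Metric.isOpen_iff.mp seg_isCompact.isClosed.isOpen_compl z hz
  have key : ∀ t ∈ Set.Icc (-1:ℝ) 1, ∀ y ∈ Metric.ball z (δ/2), δ/2 ≤ ‖y - (t:ℂ)‖ := by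
    intro t ht y hy
    have h1 : δ ≤ ‖z - (t:ℂ)‖ := by
      by_contra hc
      push Not at hc
      have : (t:ℂ) ∈ Metric.ball z δ := by
        rw [Metric.mem_ball, dist_comm, dist_eq_norm]; exact hc
      exact hball this ⟨t, ht, rfl⟩
    have h2 : ‖z - y‖ < δ/2 := by
      rw [Metric.mem_ball, dist_comm, dist_eq_norm] at hy; exact hy
    have h3 : ‖z - (t:ℂ)‖ ≤ ‖z - y‖ + ‖y - (t:ℂ)‖ := by
      have := norm_add_le (z - y) (y - (t:ℂ))
      simpa using this
    linarith
  have hzb : z ∈ Metric.ball z (δ/2) := Metric.mem_ball_self (by positivity)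
  have := intervalIntegral.hasDerivAt_integral_of_dominated_loc_of_deriv_le (𝕜 := ℂ) (μ := volume)
    (a := -1) (b := 1) (F := fun (z:ℂ) (t:ℝ) => (g t : ℂ) / (z - (t:ℂ)))
    (F' := fun (z:ℂ) (t:ℝ) => - (g t : ℂ) / (z - (t:ℂ))^2)
    (bound := fun t => |g t| * (1 / (δ/2)^2)) (x₀ := z) (s := Metric.ball z (δ/2))
    (Metric.ball_mem_nhds z (by positivity))
    (Filter.Eventually.of_forall fun y => cauchy_meas hg y) ?_ ?_ ?_ ?_ ?_
  · exact this.2.differentiableAt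
  · refine IntervalIntegrable.mono_fun' (g := fun t => |g t| * (1 / (δ/2)))
      (hg.abs.mul_const _) (cauchy_meas hg z) ?_
    refine (ae_restrict_iff' measurableSet_uIoc).mpr (Filter.Eventually.of_forall fun t ht => ?_)
    have := key t (uIoc_mem_Icc ht) z hzb
    simp only [norm_div, Complex.norm_real, Real.norm_eq_abs]
    rw [div_eq_mul_one_div]
    gcongr
  · have h1 : AEStronglyMeasurable g (volume.restrict (Set.uIoc (-1:ℝ) 1)) :=
      hg.def'.aestronglyMeasurable
    have h2 : Measurable (fun t : ℝ => ((z - (t:ℂ))^2)⁻¹) := by fun_prop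
    simp only [div_eq_mul_inv]
    exact (Complex.continuous_ofReal.comp_aestronglyMeasurable h1).neg.mul h2.aestronglyMeasurable
  · refine Filter.Eventually.of_forall fun t ht y hy => ?_
    have := key t (uIoc_mem_Icc ht) y hy
    simp only [norm_div, norm_neg, norm_pow, Complex.norm_real, Real.norm_eq_abs]
    rw [div_eq_mul_one_div]
    gcongr
  · exact hg.abs.mul_const _
  · refine Filter.Eventually.of_forall fun t ht y hy => ?_
    have h1 := key t (uIoc_mem_Icc ht) y hy
    have h2 : y - (t:ℂ) ≠ 0 := norm_pos_iff.mp (by linarith)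
    have h3 : HasDerivAt (fun y : ℂ => y - (t:ℂ)) 1 y := (hasDerivAt_id y).sub_const _
    have h4 := (hasDerivAt_const y (g t : ℂ)).fun_div h3 h2
    exact h4.congr_deriv (by ring)

theorem cauchy_inf {g : ℝ → ℝ} (hg : IntervalIntegrable g volume (-1) 1) :
    Filter.Tendsto (fun z : ℂ => z * ∫ t in (-1:ℝ)..1, (g t : ℂ) / (z - (t:ℂ)))
      (Filter.cocompact ℂ) (nhds ((∫ t in (-1:ℝ)..1, g t : ℝ) : ℂ)) := by
  have hcg : (Filter.cocompact ℂ).IsCountablyGenerated := by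
    rw [← Metric.cobounded_eq_cocompact, ← comap_norm_atTop]
    infer_instance
  have hn : ∀ᶠ z : ℂ in Filter.cocompact ℂ, 2 ≤ ‖z‖ :=
    (tendsto_norm_cocompact_atTop (E := ℂ)).eventually_ge_atTop 2
  rw [← intervalIntegral.integral_ofReal]
  simp_rw [← intervalIntegral.integral_const_mul]
  refine intervalIntegral.tendsto_integral_filter_of_dominated_convergence
    (fun t => 2 * |g t|) ?_ ?_ ?_ ?_
  · exact Filter.Eventually.of_forall fun z => (cauchy_meas hg z).const_mul z
  · filter_upwards [hn] with z hz
    refine Filter.Eventually.of_forall fun t ht => ?_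
    have ht' := uIoc_mem_Icc ht
    have h1 : ‖(t:ℂ)‖ ≤ 1 := by
      rw [Complex.norm_real, Real.norm_eq_abs, abs_le]; exact ht'
    have h2 : ‖z‖ / 2 ≤ ‖z - (t:ℂ)‖ := by
      have := norm_sub_norm_le z (t:ℂ)
      linarith
    simp only [norm_mul, norm_div, Complex.norm_real, Real.norm_eq_abs]
    rw [← mul_div_assoc, div_le_iff₀ (by linarith)]
    nlinarith [abs_nonneg (g t)]
  · exact hg.abs.const_mul 2
  · refine Filter.Eventually.of_forall fun t ht => ?_
    have h0 : Filter.Tendsto (fun z : ℂ => (t:ℂ) / z) (Filter.cocompact ℂ) (nhds 0) := by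
      have := (tendsto_inv₀_cobounded (α := ℂ))
      rw [Metric.cobounded_eq_cocompact] at this
      simpa [div_eq_mul_inv] using this.const_mul (t:ℂ)
    have h1 : Filter.Tendsto (fun z : ℂ => (g t : ℂ) / (1 - (t:ℂ) / z)) (Filter.cocompact ℂ)
        (nhds ((g t : ℂ) / (1 - 0))) :=
      tendsto_const_nhds.div (tendsto_const_nhds.sub h0) (by norm_num)
    rw [sub_zero, div_one] at h1
    refine h1.congr' ?_
    filter_upwards [hn] with z hz
    have hz0 : z ≠ 0 := norm_pos_iff.mp (by linarith)
    have ht' := uIoc_mem_Icc ht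
    have h1 : ‖(t:ℂ)‖ ≤ 1 := by
      rw [Complex.norm_real, Real.norm_eq_abs, abs_le]; exact ht'
    have h2 : z - (t:ℂ) ≠ 0 := by
      apply norm_pos_iff.mp
      have := norm_sub_norm_le z (t:ℂ)
      linarith
    have h3 : 1 - (t:ℂ) / z = (z - t) / z := by field_simp
    rw [h3]
    field_simp

theorem s_im_pos {s : ℂ → ℂ} (hs : ContinuousOn s segᶜ)
    (hs2 : ∀ z ∈ segᶜ, s z ^ 2 = z ^ 2 - 1)
    (hsinf : Filter.Tendsto (fun z => s z / z) (Filter.cocompact ℂ) (nhds 1))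
    (x : ℝ) (σ : ℝ) (hσ : σ ≠ 0) {ε : ℝ} (hε : 0 < ε) :
    0 < σ * (s ((x:ℂ) + ((σ * ε : ℝ):ℂ) * Complex.I)).im := by
  have hmem : ∀ τ : ℝ, 0 < τ → (x:ℂ) + ((σ * τ : ℝ):ℂ) * Complex.I ∈ segᶜ := by
    intro τ hτ
    apply im_mem_compl
    simp [hσ, hτ.ne']
  set f : ℝ → ℝ := fun τ => σ * (s ((x:ℂ) + ((σ * τ : ℝ):ℂ) * Complex.I)).im with hf
  have hcont : ContinuousOn f (Set.Ici ε) := by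
    refine continuousOn_const.mul (Complex.continuous_im.comp_continuousOn ?_)
    refine hs.comp (Continuous.continuousOn (by fun_prop)) ?_
    intro τ hτ
    exact hmem τ (lt_of_lt_of_le hε hτ)
  have hne : ∀ τ ∈ Set.Ici ε, f τ ≠ 0 := by
    intro τ hτ h0
    have hτ0 : 0 < τ := lt_of_lt_of_le hε hτ
    have him : (s ((x:ℂ) + ((σ * τ : ℝ):ℂ) * Complex.I)).im = 0 := by
      rcases mul_eq_zero.mp h0 with h | h
      · exact absurd h hσ
      · exact h
    have hsq := hs2 _ (hmem τ hτ0)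
    generalize s ((x:ℂ) + ((σ * τ : ℝ):ℂ) * Complex.I) = q at him hsq
    have hre := congrArg Complex.re hsq
    have himm := congrArg Complex.im hsq
    simp [pow_two, him] at hre himm
    have hστ : 0 < (σ * τ) * (σ * τ) := mul_self_pos.mpr (mul_ne_zero hσ hτ0.ne')
    have hx : x = 0 := by
      have : x * (σ * τ) = 0 := by linarith
      rcases mul_eq_zero.mp this with h | h
      · exact h
      · rw [h] at hστ; simp at hστ
    rw [hx] at hre
    nlinarith [mul_self_nonneg q.re]
  have hlarge : ∃ T ∈ Set.Ici ε, 0 < f T := by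
    have hpath : Filter.Tendsto (fun τ : ℝ => (x:ℂ) + ((σ * τ : ℝ):ℂ) * Complex.I) Filter.atTop
        (Filter.cocompact ℂ) := by
      rw [← Metric.cobounded_eq_cocompact, ← tendsto_norm_atTop_iff_cobounded]
      refine Filter.tendsto_atTop_mono (f := fun τ : ℝ => |σ| * τ) ?_
        (Filter.tendsto_id.const_mul_atTop (abs_pos.mpr hσ))
      intro τ
      refine le_trans ?_ (Complex.abs_im_le_norm _)
      simp only [Complex.add_im, Complex.ofReal_im, Complex.mul_im, Complex.ofReal_re,
        Complex.I_im, Complex.I_re, mul_zero, mul_one, zero_add, add_zero, abs_mul]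
      gcongr
      exact le_abs_self τ
    have h1 := hsinf.comp hpath
    have h2 : Filter.Tendsto (fun τ : ℝ => ((x:ℂ) / (τ:ℂ) + (σ:ℂ) * Complex.I)) Filter.atTop
        (nhds (0 + (σ:ℂ) * Complex.I)) := by
      refine Filter.Tendsto.add_const _ ?_
      have := (Complex.continuous_ofReal.tendsto 0).comp
        (tendsto_inv_atTop_zero (𝕜 := ℝ))
      have h3 := this.const_mul (x:ℂ)
      simpa [div_eq_mul_inv, Function.comp_def] using h3
    have h3 := h1.mul h2
    have h4 := (Complex.continuous_im.tendsto _).comp h3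
    have h5 : Filter.Tendsto (fun τ => f τ / τ) Filter.atTop (nhds (σ * σ)) := by
      have h6 := h4.const_mul σ
      simp only [one_mul, zero_add, Complex.mul_im, Complex.ofReal_re, Complex.I_im, mul_one,
        Complex.ofReal_im, Complex.I_re, mul_zero, add_zero] at h6
      refine h6.congr' ?_
      filter_upwards [Filter.eventually_gt_atTop 0] with τ hτ
      simp only [Function.comp_apply, hf]
      have hz0 : (x:ℂ) + ((σ * τ : ℝ):ℂ) * Complex.I ≠ 0 := by
        intro h0
        have := congrArg Complex.im h0
        simp [hσ, hτ.ne'] at this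
      have hτ0 : (τ:ℂ) ≠ 0 := by exact_mod_cast hτ.ne'
      have : s ((x:ℂ) + ((σ * τ : ℝ):ℂ) * Complex.I) / ((x:ℂ) + ((σ * τ : ℝ):ℂ) * Complex.I) *
          ((x:ℂ) / (τ:ℂ) + (σ:ℂ) * Complex.I) =
          s ((x:ℂ) + ((σ * τ : ℝ):ℂ) * Complex.I) / (τ:ℂ) := by
        have h7 : ((x:ℂ) / (τ:ℂ) + (σ:ℂ) * Complex.I) =
          ((x:ℂ) + ((σ * τ : ℝ):ℂ) * Complex.I) / (τ:ℂ) := by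
          push_cast
          field_simp
        rw [h7]
        generalize s ((x:ℂ) + ((σ * τ : ℝ):ℂ) * Complex.I) = q
        generalize (x:ℂ) + ((σ * τ : ℝ):ℂ) * Complex.I = p at hz0 ⊢
        field_simp
      rw [this, Complex.div_ofReal_im]
      ring
    have hpos : 0 < σ * σ := mul_self_pos.mpr hσ
    obtain ⟨T, hT1, hT2⟩ := ((h5.eventually (lt_mem_nhds hpos)).and
      (Filter.eventually_ge_atTop ε)).exists
    refine ⟨T, hT2, ?_⟩
    have hT0 : 0 < T := lt_of_lt_of_le hε hT2
    have := mul_pos hT1 hT0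
    rwa [div_mul_cancel₀ _ hT0.ne'] at this
  obtain ⟨T, hT, hfT⟩ := hlarge
  by_contra hc
  push Not at hc
  obtain ⟨c, hc1, hc2⟩ := isPreconnected_Ici.intermediate_value (Set.self_mem_Ici) hT hcont
    (show (0:ℝ) ∈ Set.Icc (f ε) (f T) from ⟨hc, hfT.le⟩)
  exact hne c hc1 hc2

theorem s_lim {s : ℂ → ℂ} (hs : ContinuousOn s segᶜ)
    (hs2 : ∀ z ∈ segᶜ, s z ^ 2 = z ^ 2 - 1)
    (hsinf : Filter.Tendsto (fun z => s z / z) (Filter.cocompact ℂ) (nhds 1))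
    {x : ℝ} (hx : x ∈ Set.Ioo (-1:ℝ) 1) (σ : ℝ) (hσ : σ * σ = 1) :
    Filter.Tendsto (fun ε : ℝ => s ((x:ℂ) + ((σ * ε : ℝ):ℂ) * Complex.I))
      (nhdsWithin 0 (Set.Ioi 0)) (nhds ((σ:ℂ) * Complex.I * (Real.sqrt (1 - x^2) : ℂ))) := by
  have hσ0 : σ ≠ 0 := by rintro rfl; simp at hσ
  have hσc : (σ:ℂ) * σ = 1 := by exact_mod_cast hσ
  have hpos : 0 < 1 - x^2 := by nlinarith [hx.1, hx.2]
  have h1 : Filter.Tendsto (fun ε : ℝ => 1 - ((x:ℂ) + ((σ * ε : ℝ):ℂ) * Complex.I)^2)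
      (nhdsWithin 0 (Set.Ioi 0)) (nhds ((1 - x^2 : ℝ) : ℂ)) := by
    have : Continuous (fun ε : ℝ => 1 - ((x:ℂ) + ((σ * ε : ℝ):ℂ) * Complex.I)^2) := by fun_prop
    have h2 := (this.tendsto 0).mono_left (nhdsWithin_le_nhds (s := Set.Ioi 0))
    simpa using h2
  have h2 : ContinuousAt (fun z : ℂ => z ^ (((2:ℕ):ℂ)⁻¹)) ((1 - x^2 : ℝ) : ℂ) := by
    apply ContinuousAt.cpow continuousAt_id continuousAt_const
    exact Complex.ofReal_mem_slitPlane.mpr hpos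
  have h3 := (h2.tendsto.comp h1).const_mul ((σ:ℂ) * Complex.I)
  have h4 : ((1 - x^2 : ℝ) : ℂ) ^ (((2:ℕ):ℂ)⁻¹) = (Real.sqrt (1 - x^2) : ℂ) := by
    rw [Real.sqrt_eq_rpow, Complex.ofReal_cpow hpos.le]
    norm_num
  rw [h4] at h3
  refine h3.congr' ?_
  filter_upwards [self_mem_nhdsWithin] with ε hε
  have hε0 : 0 < ε := hε
  have h5 := s_im_pos hs hs2 hsinf x σ hσ0 hε0
  have h6 := hs2 ((x:ℂ) + ((σ * ε : ℝ):ℂ) * Complex.I) (im_mem_compl (by simp [hσ0, hε0.ne']))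
  simp only [Function.comp_apply]
  generalize s ((x:ℂ) + ((σ * ε : ℝ):ℂ) * Complex.I) = q at h5 h6 ⊢
  have h7 : 1 - ((x:ℂ) + ((σ * ε : ℝ):ℂ) * Complex.I)^2 = (-(σ:ℂ) * Complex.I * q)^2 := by
    have : (-(σ:ℂ) * Complex.I * q)^2 = (σ * σ) * (Complex.I * Complex.I) * q^2 := by ring
    rw [this, hσc, Complex.I_mul_I, h6]; ring
  have h8 : 0 < (-(σ:ℂ) * Complex.I * q).re := by simpa using h5
  rw [h7]
  have h9 := Complex.abs_arg_lt_pi_div_two_iff.mpr (Or.inl h8)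
  rw [abs_lt] at h9
  rw [Complex.pow_cpow_nat_inv (by norm_num) (by simpa using h9.1) (by simpa using h9.2.le)]
  have : (σ:ℂ) * Complex.I * (-(σ:ℂ) * Complex.I * q) = -(σ * σ) * (Complex.I * Complex.I) * q := by
    ring
  rw [this, hσc, Complex.I_mul_I]; ring

theorem cauchy_pv {g : ℝ → ℝ} (hg : IntervalIntegrable g volume (-1) 1) {x : ℝ}
    (hgx : DifferentiableAt ℝ g x) :
    Filter.Tendsto (fun η : ℝ => ∫ t in (-1:ℝ)..1,
        (((g t - g x : ℝ)) : ℂ) / ((x:ℂ) + (η:ℂ) * Complex.I - (t:ℂ))) (nhds 0)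
      (nhds (∫ t in (-1:ℝ)..1, (((g t - g x : ℝ)) : ℂ) / ((x:ℂ) - (t:ℂ)))) := by
  obtain ⟨K, hK⟩ := hgx.hasDerivAt.isBigO_sub.bound
  obtain ⟨δ, hδ, hball⟩ := Metric.eventually_nhds_iff.mp hK
  have hg' : IntervalIntegrable (fun t => g t - g x) volume (-1) 1 :=
    hg.sub intervalIntegrable_const
  have hnorm : ∀ η t : ℝ, |t - x| ≤ ‖(x:ℂ) + (η:ℂ) * Complex.I - (t:ℂ)‖ := by
    intro η t
    have := Complex.abs_re_le_norm ((x:ℂ) + (η:ℂ) * Complex.I - (t:ℂ))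
    rw [abs_sub_comm]
    simpa using this
  refine intervalIntegral.tendsto_integral_filter_of_dominated_convergence
    (fun t => |K| + (|g t - g x|) * (1/δ)) ?_ ?_ ?_ ?_
  · exact Filter.Eventually.of_forall fun η => cauchy_meas hg' _
  · refine Filter.Eventually.of_forall fun η => Filter.Eventually.of_forall fun t ht => ?_
    have h1 := hnorm η t
    simp only [norm_div, Complex.norm_real, Real.norm_eq_abs]
    generalize ‖(x:ℂ) + (η:ℂ) * Complex.I - (t:ℂ)‖ = N at h1
    by_cases hc : |t - x| < δ
    · have h2 := hball (y := t) (by rwa [Real.dist_eq])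
      simp only [Real.norm_eq_abs] at h2
      have h3 : |g t - g x| / N ≤ |K| := by
        refine div_le_of_le_mul₀ (le_trans (abs_nonneg _) h1) (abs_nonneg _) (h2.trans ?_)
        calc K * |t - x| ≤ |K| * |t - x| := by gcongr; exact le_abs_self K
          _ ≤ |K| * N := by gcongr
      have : 0 ≤ |g t - g x| * (1/δ) := by positivity
      linarith
    · push Not at hc
      have h3 : |g t - g x| / N ≤ |g t - g x| * (1/δ) := by
        rw [div_eq_mul_one_div]
        gcongr
        linarith
      linarith [abs_nonneg K]
  · exact intervalIntegrable_const.add (hg'.abs.mul_const _)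
  · have hae : ∀ᵐ t : ℝ, t ≠ x := by
      simp [ae_iff]
    filter_upwards [hae] with t ht _
    have hne : (x:ℂ) - (t:ℂ) ≠ 0 := by
      rw [sub_ne_zero]; exact_mod_cast ht.symm
    have h1 : Continuous fun η : ℝ => (x:ℂ) + (η:ℂ) * Complex.I - (t:ℂ) := by fun_prop
    have h2 := h1.tendsto 0
    simp only [Complex.ofReal_zero, zero_mul, add_zero] at h2
    exact tendsto_const_nhds.div h2 hne

theorem log_int {x η : ℝ} (hη : η ≠ 0) :
    IntervalIntegrable (fun t : ℝ => 1 / ((x:ℂ) + (η:ℂ) * Complex.I - (t:ℂ))) volume (-1) 1 ∧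
    ∫ t in (-1:ℝ)..1, 1 / ((x:ℂ) + (η:ℂ) * Complex.I - (t:ℂ)) =
      Complex.log ((x:ℂ) + (η:ℂ) * Complex.I + 1) - Complex.log ((x:ℂ) + (η:ℂ) * Complex.I - 1) := by
  have hne : ∀ t : ℝ, (x:ℂ) + (η:ℂ) * Complex.I - (t:ℂ) ≠ 0 := by
    intro t h0
    have := congrArg Complex.im h0
    simp [hη] at this
  have hint : IntervalIntegrable (fun t : ℝ => 1 / ((x:ℂ) + (η:ℂ) * Complex.I - (t:ℂ)))
      volume (-1) 1 := by
    apply Continuous.intervalIntegrable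
    exact continuous_const.div (by fun_prop) hne
  refine ⟨hint, ?_⟩
  rw [intervalIntegral.integral_eq_sub_of_hasDerivAt
    (f := fun t : ℝ => - Complex.log ((x:ℂ) + (η:ℂ) * Complex.I - (t:ℂ))) ?_ hint]
  · push_cast
    simp only [sub_neg_eq_add]
    ring
  · intro t _
    have h1 : HasDerivAt (fun t : ℝ => (x:ℂ) + (η:ℂ) * Complex.I - (t:ℂ)) (-1) t := by
      simpa using (Complex.ofRealCLM.hasDerivAt (x := t)).const_sub ((x:ℂ) + (η:ℂ) * Complex.I)
    have h2 := (h1.clog_real (Or.inr (by simp [hη]))).neg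
    refine h2.congr_deriv ?_
    ring

theorem cauchy_split {g : ℝ → ℝ} (hg : IntervalIntegrable g volume (-1) 1) (x : ℝ)
    {η : ℝ} (hη : η ≠ 0) :
    ∫ t in (-1:ℝ)..1, (g t : ℂ) / ((x:ℂ) + (η:ℂ) * Complex.I - (t:ℂ)) =
    (∫ t in (-1:ℝ)..1, (((g t - g x : ℝ)) : ℂ) / ((x:ℂ) + (η:ℂ) * Complex.I - (t:ℂ))) +
    (g x : ℂ) * (Complex.log ((x:ℂ) + (η:ℂ) * Complex.I + 1) -
      Complex.log ((x:ℂ) + (η:ℂ) * Complex.I - 1)) := by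
  have hg' : IntervalIntegrable (fun t => g t - g x) volume (-1) 1 :=
    hg.sub intervalIntegrable_const
  have hne : ∀ t : ℝ, (x:ℂ) + (η:ℂ) * Complex.I - (t:ℂ) ≠ 0 := by
    intro t h0
    have := congrArg Complex.im h0
    simp [hη] at this
  obtain ⟨h1, h2⟩ := log_int (x := x) hη
  rw [← h2, ← intervalIntegral.integral_const_mul, ← intervalIntegral.integral_add]
  · congr 1
    ext t
    push_cast
    ring
  · have h3 : IntervalIntegrable (fun t => ((g t - g x : ℝ) : ℂ)) volume (-1) 1 := by
      exact ⟨hg'.1.ofReal, hg'.2.ofReal⟩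
    have h4 : Continuous fun t : ℝ => ((x:ℂ) + (η:ℂ) * Complex.I - (t:ℂ))⁻¹ :=
      Continuous.inv₀ (by fun_prop) hne
    simp only [div_eq_mul_inv]
    exact h3.mul_continuousOn h4.continuousOn
  · exact h1.const_mul _

theorem log_lim_up {x : ℝ} (hx : x ∈ Set.Ioo (-1:ℝ) 1) (σ : ℝ) (hσ : σ = 1 ∨ σ = -1) :
    Filter.Tendsto (fun ε : ℝ => Complex.log ((x:ℂ) + ((σ * ε : ℝ):ℂ) * Complex.I + 1) -
      Complex.log ((x:ℂ) + ((σ * ε : ℝ):ℂ) * Complex.I - 1))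
      (nhdsWithin 0 (Set.Ioi 0))
      (nhds (Complex.log ((x:ℂ) + 1) - ((Real.log ‖(x:ℂ) - 1‖ : ℂ) + σ * Real.pi * Complex.I))) := by
  have hc1 : Continuous fun ε : ℝ => (x:ℂ) + ((σ * ε : ℝ):ℂ) * Complex.I + 1 := by fun_prop
  have hc2 : Continuous fun ε : ℝ => (x:ℂ) + ((σ * ε : ℝ):ℂ) * Complex.I - 1 := by fun_prop
  have h1 := (hc1.tendsto 0).mono_left (nhdsWithin_le_nhds (s := Set.Ioi 0))
  have h2 := (hc2.tendsto 0).mono_left (nhdsWithin_le_nhds (s := Set.Ioi 0))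
  simp only [mul_zero, Complex.ofReal_zero, zero_mul, add_zero] at h1 h2
  have hre : ((x:ℂ) - 1).re < 0 := by simpa using hx.2
  have him : ((x:ℂ) - 1).im = 0 := by simp
  refine Filter.Tendsto.sub ?_ ?_
  · refine h1.clog ?_
    left
    simp
    linarith [hx.1]
  · rcases hσ with rfl | rfl
    · have h3 := Complex.tendsto_log_nhdsWithin_im_nonneg_of_re_neg_of_im_zero hre him
      have h4 := h3.comp (tendsto_nhdsWithin_iff.mpr ⟨h2, ?_⟩)
      · simpa [Function.comp_def] using h4
      · filter_upwards [self_mem_nhdsWithin] with ε hε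
        have hε0 : 0 < ε := hε
        simp [hε0.le]
    · have h3 := Complex.tendsto_log_nhdsWithin_im_neg_of_re_neg_of_im_zero hre him
      have h4 := h3.comp (tendsto_nhdsWithin_iff.mpr ⟨h2, ?_⟩)
      · simpa [Function.comp_def, sub_eq_add_neg] using h4
      · filter_upwards [self_mem_nhdsWithin] with ε hε
        have hε0 : 0 < ε := hε
        simp [hε0]

theorem cauchy_lim {g : ℝ → ℝ} (hg : IntervalIntegrable g volume (-1) 1) {x : ℝ}
    (hx : x ∈ Set.Ioo (-1:ℝ) 1) (hgx : DifferentiableAt ℝ g x) :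
    ∃ L : ℂ, ∀ σ : ℝ, (σ = 1 ∨ σ = -1) →
      Filter.Tendsto (fun ε : ℝ => ∫ t in (-1:ℝ)..1,
        (g t : ℂ) / ((x:ℂ) + ((σ * ε : ℝ):ℂ) * Complex.I - (t:ℂ)))
      (nhdsWithin 0 (Set.Ioi 0)) (nhds (L - (g x : ℂ) * (σ * Real.pi * Complex.I))) := by
  refine ⟨(∫ t in (-1:ℝ)..1, (((g t - g x : ℝ)) : ℂ) / ((x:ℂ) - (t:ℂ))) +
    (g x : ℂ) * (Complex.log ((x:ℂ) + 1) - (Real.log ‖(x:ℂ) - 1‖ : ℂ)), ?_⟩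
  intro σ hσ
  have hσ0 : σ ≠ 0 := by rcases hσ with rfl | rfl <;> norm_num
  have hc : Filter.Tendsto (fun ε : ℝ => σ * ε) (nhdsWithin 0 (Set.Ioi 0)) (nhds 0) := by
    have : Continuous fun ε : ℝ => σ * ε := by fun_prop
    simpa using (this.tendsto 0).mono_left (nhdsWithin_le_nhds (s := Set.Ioi 0))
  have h1 := (cauchy_pv hg hgx).comp hc
  have h2 := h1.add ((log_lim_up hx σ hσ).const_mul (g x : ℂ))
  have h3 : (∫ t in (-1:ℝ)..1, (((g t - g x : ℝ)) : ℂ) / ((x:ℂ) - (t:ℂ))) +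
    (g x : ℂ) * (Complex.log ((x:ℂ) + 1) - (Real.log ‖(x:ℂ) - 1‖ : ℂ)) -
      (g x : ℂ) * (σ * Real.pi * Complex.I) =
    (∫ t in (-1:ℝ)..1, (((g t - g x : ℝ)) : ℂ) / ((x:ℂ) - (t:ℂ))) +
    (g x : ℂ) * (Complex.log ((x:ℂ) + 1) -
      ((Real.log ‖(x:ℂ) - 1‖ : ℂ) + σ * Real.pi * Complex.I)) := by ring
  rw [h3]
  refine h2.congr' ?_
  filter_upwards [self_mem_nhdsWithin] with ε hε
  have hε0 : 0 < ε := hε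
  exact (cauchy_split hg x (mul_ne_zero hσ0 hε0.ne')).symm

theorem log_bound {y u : ℝ} (hy : 0 < y) (hu : 0 < u) (hyu : y + u = 2) :
    |Real.log y| ≤ Real.log 2 + 4 * (y * u) ^ (-(1/4):ℝ) := by
  have hq : 0 < y * u := by positivity
  have h1 : Real.log (y * u)⁻¹ ≤ 4 * (y * u) ^ (-(1/4):ℝ) := by
    have := Real.log_le_rpow_div (x := (y*u)⁻¹) (ε := 1/4) (by positivity) (by norm_num)
    rw [Real.inv_rpow hq.le, ← Real.rpow_neg hq.le] at this
    linarith
  rw [Real.log_inv] at h1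
  have h2 : Real.log y ≤ Real.log 2 := Real.log_le_log hy (by linarith)
  have h3 : Real.log u ≤ Real.log 2 := Real.log_le_log hu (by linarith)
  have h4 : Real.log (y * u) = Real.log y + Real.log u := Real.log_mul hy.ne' hu.ne'
  have h5 : 0 ≤ (y * u) ^ (-(1/4):ℝ) := by positivity
  rw [abs_le]
  constructor <;> linarith

theorem g_integrable {α β : ℝ} {H : ℝ → ℝ} {w : ℝ → ℝ}
    (hH : ContinuousOn H (Set.Icc (-1) 1)) (hHpos : ∀ x ∈ Set.Icc (-1:ℝ) 1, 0 < H x)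
    (hw : ∀ x ∈ Set.Ioo (-1:ℝ) 1, w x = (1 - x) ^ α * (1 + x) ^ β * H x)
    (hcont : ContinuousOn (fun x => Real.log (w x) / Real.sqrt (1 - x ^ 2)) (Set.Ioo (-1) 1)) :
    IntervalIntegrable (fun x => Real.log (w x) / Real.sqrt (1 - x ^ 2)) volume (-1) 1 := by
  obtain ⟨M, hM⟩ := isCompact_Icc.exists_bound_of_continuousOn
    (hH.log (fun x hx => (hHpos x hx).ne'))
  have hM0 : 0 ≤ M := le_trans (norm_nonneg _) (hM 0 (by norm_num))
  have hi0 : IntervalIntegrable (fun x : ℝ => x ^ (-(3/4):ℝ)) volume 0 2 :=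
    intervalIntegral.intervalIntegrable_rpow' (by norm_num)
  have hi1 : IntervalIntegrable (fun x : ℝ => (1 - x) ^ (-(3/4):ℝ)) volume (-1) 1 := by
    have := (hi0.comp_sub_left 1).symm
    norm_num at this ⊢
    exact this
  have hi2 : IntervalIntegrable (fun x : ℝ => (1 + x) ^ (-(3/4):ℝ)) volume (-1) 1 := by
    have := (hi0.comp_add_left 1)
    norm_num at this ⊢
    exact this
  set A : ℝ := |α| * (Real.log 2 + 4) + |β| * (Real.log 2 + 4) + M with hA
  have hl2 : 0 < Real.log 2 := Real.log_pos (by norm_num)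
  have hA0 : 0 ≤ A := by positivity
  have hB := ((hi1.add hi2).const_mul A)
  rw [intervalIntegrable_iff_integrableOn_Ioo_of_le (by norm_num)] at hB ⊢
  refine Integrable.mono' hB (hcont.aestronglyMeasurable measurableSet_Ioo) ?_
  refine (ae_restrict_iff' measurableSet_Ioo).mpr (Filter.Eventually.of_forall fun x hx => ?_)
  have hy : 0 < 1 - x := by linarith [hx.2]
  have hu : 0 < 1 + x := by linarith [hx.1]
  have hx' : x ∈ Set.Icc (-1:ℝ) 1 := ⟨hx.1.le, hx.2.le⟩
  have hq : 0 < (1 - x) * (1 + x) := by positivity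
  have hq1 : (1 - x) * (1 + x) ≤ 1 := by nlinarith [sq_nonneg x]
  set Q := ((1 - x) * (1 + x)) ^ (-(1/4):ℝ) with hQ
  have hQ1 : 1 ≤ Q := Real.one_le_rpow_of_pos_of_le_one_of_nonpos hq hq1 (by norm_num)
  have hb1 := log_bound hy hu (by ring)
  have hb2 := log_bound hu hy (by ring)
  rw [mul_comm (1 + x)] at hb2
  have hb3 := hM x hx'
  rw [Real.norm_eq_abs] at hb3
  have hlog : Real.log (w x) = α * Real.log (1 - x) + β * Real.log (1 + x) + Real.log (H x) := by
    rw [hw x hx, Real.log_mul (by positivity) (hHpos x hx').ne',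
      Real.log_mul (by positivity) (by positivity), Real.log_rpow hy, Real.log_rpow hu]
  have hlogb : |Real.log (w x)| ≤ A * Q := by
    rw [hlog]
    calc |α * Real.log (1 - x) + β * Real.log (1 + x) + Real.log (H x)|
        ≤ |α| * |Real.log (1 - x)| + |β| * |Real.log (1 + x)| + |Real.log (H x)| := by
          rw [← abs_mul, ← abs_mul]
          exact abs_add_three _ _ _
      _ ≤ |α| * ((Real.log 2 + 4) * Q) + |β| * ((Real.log 2 + 4) * Q) + M * Q := by
          gcongr
          · nlinarith
          · nlinarith
          · nlinarith
      _ = A * Q := by rw [hA]; ring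
  have hsq : Real.sqrt (1 - x^2) = ((1 - x) * (1 + x)) ^ (1/2:ℝ) := by
    rw [Real.sqrt_eq_rpow]; congr 1; ring
  have hprod : Q / ((1 - x) * (1 + x)) ^ (1/2:ℝ) = (1 - x) ^ (-(3/4):ℝ) * (1 + x) ^ (-(3/4):ℝ) := by
    rw [hQ, ← Real.rpow_sub hq, ← Real.mul_rpow hy.le hu.le]
    norm_num
  have hsum : (1 - x) ^ (-(3/4):ℝ) * (1 + x) ^ (-(3/4):ℝ) ≤
      (1 - x) ^ (-(3/4):ℝ) + (1 + x) ^ (-(3/4):ℝ) := by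
    have p1 : 0 < (1 - x) ^ (-(3/4):ℝ) := by positivity
    have p2 : 0 < (1 + x) ^ (-(3/4):ℝ) := by positivity
    rcases le_total 0 x with h0 | h0
    · have : (1 + x) ^ (-(3/4):ℝ) ≤ 1 :=
        Real.rpow_le_one_of_one_le_of_nonpos (by linarith) (by norm_num)
      nlinarith
    · have : (1 - x) ^ (-(3/4):ℝ) ≤ 1 :=
        Real.rpow_le_one_of_one_le_of_nonpos (by linarith) (by norm_num)
      nlinarith
  rw [Real.norm_eq_abs, abs_div, abs_of_nonneg (Real.sqrt_nonneg _), hsq]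
  have hS : 0 < ((1 - x) * (1 + x)) ^ (1/2:ℝ) := by positivity
  calc |Real.log (w x)| / ((1 - x) * (1 + x)) ^ (1/2:ℝ)
      ≤ (A * Q) / ((1 - x) * (1 + x)) ^ (1/2:ℝ) := by gcongr
    _ = A * ((1 - x) ^ (-(3/4):ℝ) * (1 + x) ^ (-(3/4):ℝ)) := by rw [mul_div_assoc, hprod]
    _ ≤ A * ((1 - x) ^ (-(3/4):ℝ) + (1 + x) ^ (-(3/4):ℝ)) := by gcongr

theorem stmt15
    (α β : ℝ) (hα : -1 < α) (hβ : -1 < β)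
    (U : Set ℂ) (hUopen : IsOpen U) (hUseg : seg ⊆ U)
    (h : ℂ → ℂ) (hh : AnalyticOn ℂ h U)
    (hhre : ∀ z ∈ U, 0 < (h z).re)
    (hhreal : ∀ x ∈ Set.Icc (-1:ℝ) 1, (h (x:ℂ)).im = 0)
    (w : ℝ → ℝ)
    (hw : ∀ x ∈ Set.Ioo (-1:ℝ) 1, w x = (1 - x) ^ α * (1 + x) ^ β * (h (x:ℂ)).re)
    (s : ℂ → ℂ) (hs : AnalyticOn ℂ s segᶜ)
    (hs2 : ∀ z ∈ segᶜ, s z ^ 2 = z ^ 2 - 1)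
    (hsinf : Filter.Tendsto (fun z => s z / z) (Filter.cocompact ℂ) (nhds 1))
    (D : ℂ → ℂ)
    (hD : ∀ z ∈ segᶜ, D z = Complex.exp (s z / (2 * Real.pi) *
      ∫ x in (-1:ℝ)..1, ((Real.log (w x) / Real.sqrt (1 - x ^ 2) : ℝ) : ℂ) / (z - (x:ℂ))))
    (Dinf : ℝ)
    (hDinf : Dinf = Real.exp ((1 / (2 * Real.pi)) *
      ∫ x in (-1:ℝ)..1, Real.log (w x) / Real.sqrt (1 - x ^ 2)))
    :
    (AnalyticOn ℂ D segᶜ ∧ ∀ z ∈ segᶜ, D z ≠ 0) ∧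
    (∀ x ∈ Set.Ioo (-1:ℝ) 1, ∃ Dp Dm : ℂ,
      Filter.Tendsto (fun ε : ℝ => D ((x:ℂ) + (ε:ℂ) * Complex.I))
        (nhdsWithin 0 (Set.Ioi 0)) (nhds Dp) ∧
      Filter.Tendsto (fun ε : ℝ => D ((x:ℂ) - (ε:ℂ) * Complex.I))
        (nhdsWithin 0 (Set.Ioi 0)) (nhds Dm) ∧
      Dp * Dm = (w x : ℂ)) ∧
    (Filter.Tendsto D (Filter.cocompact ℂ) (nhds (Dinf : ℂ)) ∧ 0 < Dinf) := by
  have hopen : IsOpen segᶜ := seg_isCompact.isClosed.isOpen_compl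
  have hhan : AnalyticOnNhd ℂ h U := hUopen.analyticOn_iff_analyticOnNhd.mp hh
  set H : ℝ → ℝ := fun x => (h (x:ℂ)).re with hHdef
  have hmemU : ∀ x ∈ Set.Icc (-1:ℝ) 1, (x:ℂ) ∈ U := fun x hx => hUseg ⟨x, hx, rfl⟩
  have hHpos : ∀ x ∈ Set.Icc (-1:ℝ) 1, 0 < H x := fun x hx => hhre _ (hmemU x hx)
  have hHdiff : ∀ x ∈ Set.Icc (-1:ℝ) 1, DifferentiableAt ℝ H x := fun x hx =>
    ((hhan _ (hmemU x hx)).differentiableAt.hasDerivAt.real_of_complex).differentiableAt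
  have hwpos : ∀ x ∈ Set.Ioo (-1:ℝ) 1, 0 < w x := by
    intro x hx
    have hy : 0 < 1 - x := by linarith [hx.2]
    have hu : 0 < 1 + x := by linarith [hx.1]
    have := hHpos x ⟨hx.1.le, hx.2.le⟩
    rw [hw x hx]
    positivity
  set g : ℝ → ℝ := fun x => Real.log (w x) / Real.sqrt (1 - x ^ 2) with hgdef
  have hgdiff : ∀ x ∈ Set.Ioo (-1:ℝ) 1, DifferentiableAt ℝ g x := by
    intro x hx
    have hy : 0 < 1 - x := by linarith [hx.2]
    have hu : 0 < 1 + x := by linarith [hx.1]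
    have hq : 0 < 1 - x ^ 2 := by nlinarith
    have hHx := hHdiff x ⟨hx.1.le, hx.2.le⟩
    have hwd : DifferentiableAt ℝ w x := by
      have : DifferentiableAt ℝ (fun x : ℝ => (1 - x) ^ α * (1 + x) ^ β * H x) x := by
        refine DifferentiableAt.mul (DifferentiableAt.mul ?_ ?_) hHx
        · exact DifferentiableAt.rpow_const (by fun_prop) (Or.inl hy.ne')
        · exact DifferentiableAt.rpow_const (by fun_prop) (Or.inl hu.ne')
      refine this.congr_of_eventuallyEq ?_
      filter_upwards [isOpen_Ioo.mem_nhds hx] with t ht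
      exact hw t ht
    refine DifferentiableAt.div (hwd.log (hwpos x hx).ne') ?_ (Real.sqrt_pos.mpr hq).ne'
    exact DifferentiableAt.sqrt (by fun_prop) hq.ne'
  have hg : IntervalIntegrable g volume (-1) 1 :=
    g_integrable (fun x hx => (hHdiff x hx).continuousAt.continuousWithinAt) hHpos hw
      (fun x hx => (hgdiff x hx).continuousAt.continuousWithinAt)
  have hDan : AnalyticOn ℂ D segᶜ := by
    refine AnalyticOnNhd.analyticOn (DifferentiableOn.analyticOnNhd ?_ hopen)
    refine DifferentiableOn.congr (fun z hz => ?_) hD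
    refine DifferentiableWithinAt.cexp ?_
    refine DifferentiableWithinAt.mul ?_ (cauchy_diff hg hz).differentiableWithinAt
    exact ((hs.differentiableOn) z hz).div_const _
  refine ⟨⟨hDan, fun z hz => by rw [hD z hz]; exact Complex.exp_ne_zero _⟩, ?_, ?_, ?_⟩
  · intro x hx
    obtain ⟨L, hL⟩ := cauchy_lim hg hx (hgdiff x hx)
    have hlim : ∀ σ : ℝ, (σ = 1 ∨ σ = -1) →
        Filter.Tendsto (fun ε : ℝ => D ((x:ℂ) + ((σ * ε : ℝ):ℂ) * Complex.I))
          (nhdsWithin 0 (Set.Ioi 0)) (nhds (Complex.exp (((σ:ℂ) * Complex.I *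
            (Real.sqrt (1 - x^2) : ℂ)) / (2 * Real.pi) *
              (L - (g x : ℂ) * (σ * Real.pi * Complex.I))))) := by
      intro σ hσ
      have hσ2 : σ * σ = 1 := by rcases hσ with rfl | rfl <;> norm_num
      have hσ0 : σ ≠ 0 := by rintro rfl; simp at hσ2
      have h1 := ((s_lim hs.continuousOn hs2 hsinf hx σ hσ2).div_const (2 * (Real.pi:ℂ))).mul
        (hL σ hσ)
      refine h1.cexp.congr' ?_
      filter_upwards [self_mem_nhdsWithin] with ε hε
      have hε0 : 0 < ε := hε
      rw [hD _ (im_mem_compl (by simp [hσ0, hε0.ne']))]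
    have hp := hlim 1 (Or.inl rfl)
    have hm := hlim (-1) (Or.inr rfl)
    refine ⟨_, _, hp.congr fun ε => by simp, hm.congr fun ε => by simp [sub_eq_add_neg], ?_⟩
    · have hq : 0 < 1 - x ^ 2 := by nlinarith [hx.1, hx.2]
      have hpi : (Real.pi : ℂ) ≠ 0 := by exact_mod_cast Real.pi_ne_zero
      have hgx : (Real.sqrt (1 - x^2) : ℂ) * (g x : ℂ) = (Real.log (w x) : ℂ) := by
        rw [← Complex.ofReal_mul]
        congr 1
        simp only [hgdef]
        rw [mul_div_cancel₀ _ (Real.sqrt_pos.mpr hq).ne']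
      rw [← Complex.exp_add, ← Real.exp_log (hwpos x hx), Complex.ofReal_exp, ← hgx]
      congr 1
      push_cast
      field_simp
      ring_nf
      rw [Complex.I_sq]
      ring
  · have h1 := cauchy_inf hg
    have h2 := ((hsinf.mul h1).const_mul (1 / (2 * (Real.pi:ℂ)))).cexp
    have h3 : Complex.exp (1 / (2 * (Real.pi:ℂ)) * (1 * ((∫ t in (-1:ℝ)..1, g t : ℝ) : ℂ))) =
        (Dinf : ℂ) := by
      rw [hDinf]
      push_cast
      rw [one_mul]
    rw [h3] at h2
    refine h2.congr' ?_
    have hc1 : ∀ᶠ z : ℂ in Filter.cocompact ℂ, z ∈ segᶜ := seg_isCompact.compl_mem_cocompact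
    have hc2 : ∀ᶠ z : ℂ in Filter.cocompact ℂ, z ≠ 0 :=
      (isCompact_singleton (x := (0:ℂ))).compl_mem_cocompact
    filter_upwards [hc1, hc2] with z hz hz0
    rw [hD z hz]
    congr 1
    simp only [hgdef]
    generalize (∫ x in (-1:ℝ)..1, ((Real.log (w x) / Real.sqrt (1 - x ^ 2) : ℝ) : ℂ) / (z - (x:ℂ)))
      = J
    field_simp
  · rw [hDinf]
    exact Real.exp_pos _
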